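/- Let A be a proper and Helly arc model for a non-chordal graph G, and for a vertex v let h(v) denote the minimum length of a hole of G containing v (h(v) = +∞ if none exists). Let v_1, v_2, ..., v_p be a sequence of vertices such that for each i = 2, ..., p, the arc A(v_i) contains cp(v_{i−1}) and is the rightmost such arc, i.e., every vertex u ≠ v_i with cp(v_{i−1}) ∈ A(u) satisfies cp(u) ∈ A(v_i). If v_1 is contained in some hole of G and v_i is not adjacent to v_1 for all 2 < i ≤ p, then there is a hole of G of length h(v_1) containing v_1, v_2, ..., v_p as consecutive vertices on it. -/

import Mathlib

/-- A unit interval graph: vertices can be mapped to reals so that two distinct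
vertices are adjacent iff their images are within distance 1. -/
def SimpleGraph.IsUnitIntervalGraph {V : Type*} (G : SimpleGraph V) : Prop :=
  ∃ f : V → ℝ, ∀ u v : V, u ≠ v → (G.Adj u v ↔ |f u - f v| ≤ 1)

/-- `f : ZMod n → V` describes a hole (induced cycle of length `n ≥ 4`) of `G`. -/
def SimpleGraph.IsHoleOn {V : Type*} (G : SimpleGraph V) (n : ℕ) (f : ZMod n → V) : Prop :=
  4 ≤ n ∧ Function.Injective f ∧
    ∀ i j : ZMod n, (G.Adj (f i) (f j) ↔ (i = j + 1 ∨ j = i + 1))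

def SimpleGraph.HasHole {V : Type*} (G : SimpleGraph V) : Prop :=
  ∃ (n : ℕ) (f : ZMod n → V), G.IsHoleOn n f

/-- A graph is chordal if it has no hole. -/
def SimpleGraph.Chordal {V : Type*} (G : SimpleGraph V) : Prop := ¬ G.HasHole

/-- `G` contains an induced copy of `H`. -/
def SimpleGraph.HasInducedCopy {V W : Type*} (G : SimpleGraph V) (H : SimpleGraph W) : Prop :=
  ∃ f : W → V, Function.Injective f ∧ ∀ a b : W, G.Adj (f a) (f b) ↔ H.Adj a b

/-- The claw `K_{1,3}`, centered at vertex `0`. -/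
def clawGraph : SimpleGraph (Fin 4) := SimpleGraph.fromRel (fun a _ => a = 0)

/-- The tent `S_3`: triangle on `0,1,2`; vertex `i+3` adjacent to `{0,1,2} \ {i}`. -/
def tentGraph : SimpleGraph (Fin 6) := SimpleGraph.fromRel (fun a b =>
  (a.val < 3 ∧ b.val < 3) ∨ (a.val < 3 ∧ 3 ≤ b.val ∧ b.val ≠ a.val + 3))

/-- The net: triangle on `0,1,2`; pendant vertex `i+3` adjacent exactly to `i`. -/
def netGraph : SimpleGraph (Fin 6) := SimpleGraph.fromRel (fun a b =>
  (a.val < 3 ∧ b.val < 3) ∨ (a.val < 3 ∧ b.val = a.val + 3))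

/-- The cycle `C_n` on `ZMod n`. -/
def cycleG (n : ℕ) : SimpleGraph (ZMod n) := SimpleGraph.fromRel (fun a b => a = b + 1)

/-- The wheel `W_n`: a cycle `C_n` plus a hub (`none`) adjacent to all cycle vertices. -/
def wheelG (n : ℕ) : SimpleGraph (Option (ZMod n)) := SimpleGraph.fromRel (fun a b =>
  a = none ∨ ∃ i j : ZMod n, a = some i ∧ b = some j ∧ i = j + 1)

/-- `C*_n`: a cycle `C_n` plus an isolated vertex (`none`). -/
def cycleStarG (n : ℕ) : SimpleGraph (Option (ZMod n)) := SimpleGraph.fromRel (fun a b =>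
  ∃ i j : ZMod n, a = some i ∧ b = some j ∧ i = j + 1)

/-- Raw data of a family of closed arcs on the circle `ℝ/Lℤ`: each vertex `v` gets the
arc traversed clockwise from (the image of) `src v` to `src v + len v`. -/
structure PreArcModel (V : Type*) where
  L : ℝ
  L_pos : 0 < L
  src : V → ℝ
  len : V → ℝ
  len_pos : ∀ v, 0 < len v
  len_lt : ∀ v, len v < L

namespace PreArcModel

variable {V : Type*}

/-- The counterclockwise endpoint of the arc of `v`. -/
noncomputable def ccp (A : PreArcModel V) (v : V) : AddCircle A.L := (A.src v : ℝ)

/-- The clockwise endpoint of the arc of `v`. -/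
noncomputable def cp (A : PreArcModel V) (v : V) : AddCircle A.L :=
  ((A.src v + A.len v : ℝ) : AddCircle A.L)

/-- The closed arc assigned to `v`, as a subset of the circle. -/
noncomputable def arc (A : PreArcModel V) (v : V) : Set (AddCircle A.L) :=
  (fun x : ℝ => (x : AddCircle A.L)) '' Set.Icc (A.src v) (A.src v + A.len v)

/-- All endpoints of all arcs are pairwise distinct. -/
def EndpointsDistinct (A : PreArcModel V) : Prop :=
  Function.Injective (fun p : V × Bool => if p.2 then A.cp p.1 else A.ccp p.1)

/-- `A` is an arc model of the graph `G`: endpoints are pairwise distinct and two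
distinct vertices are adjacent iff their arcs intersect. -/
def IsModelOf (A : PreArcModel V) (G : SimpleGraph V) : Prop :=
  A.EndpointsDistinct ∧ ∀ u v : V, u ≠ v → (G.Adj u v ↔ (A.arc u ∩ A.arc v).Nonempty)

/-- No arc is properly contained in another arc. -/
def Proper (A : PreArcModel V) : Prop := ∀ u v : V, ¬ A.arc u ⊂ A.arc v

/-- Every set of pairwise intersecting arcs has a common point. -/
def Helly (A : PreArcModel V) : Prop :=
  ∀ S : Set V, (∀ u ∈ S, ∀ v ∈ S, (A.arc u ∩ A.arc v).Nonempty) →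
    (⋂ v ∈ S, A.arc v).Nonempty

/-- The set `K_A(α)` of vertices whose arc contains the point `α`. -/
noncomputable def K (A : PreArcModel V) (α : AddCircle A.L) : Set V := {v | α ∈ A.arc v}

/-- The edge set `E→_A(α)`: edges `vu` of `G` with `v ∈ K_A(α)`, `u ∉ K_A(α)`,
and `A(v)` intersecting `A(u)` from the left (`cp v ∈ A(u)`). -/
noncomputable def Eout (A : PreArcModel V) (G : SimpleGraph V) (α : AddCircle A.L) :
    Set (Sym2 V) :=
  {e | ∃ v u : V, e = s(v, u) ∧ G.Adj v u ∧ α ∈ A.arc v ∧ α ∉ A.arc u ∧ A.cp v ∈ A.arc u}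

/-- The edge set `E→_{A - Vm}(α)` of the model obtained by removing the arcs of `Vm`. -/
noncomputable def EoutAvoid (A : PreArcModel V) (G : SimpleGraph V) (Vm : Set V)
    (α : AddCircle A.L) : Set (Sym2 V) :=
  {e | ∃ v u : V, e = s(v, u) ∧ G.Adj v u ∧ v ∉ Vm ∧ u ∉ Vm ∧
    α ∈ A.arc v ∧ α ∉ A.arc u ∧ A.cp v ∈ A.arc u}

end PreArcModel

/-- A proper Helly circular-arc graph: a graph admitting an arc model that is both
proper and Helly. -/
def SimpleGraph.IsPHCA {V : Type*} (G : SimpleGraph V) : Prop :=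
  ∃ A : PreArcModel V, A.IsModelOf G ∧ A.Proper ∧ A.Helly

/-- Adjacency pattern of a fat `W_5` among the six clique-classes: classes `0..4`
form the fat hole (consecutive classes modulo 5 are completely adjacent), class `5`
is the hub (completely adjacent to everything), and each class is a clique. -/
def fatW5Rel (p q : Fin 6) : Prop :=
  p = q ∨ p = 5 ∨ q = 5 ∨ (p.val + 1) % 5 = q.val ∨ (q.val + 1) % 5 = p.val

/-- A fat `W_5`: vertex set partitioned into six nonempty cliques with the `W_5`
adjacency pattern between the classes. -/
def SimpleGraph.IsFatW5 {V : Type*} (G : SimpleGraph V) : Prop :=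
  ∃ part : V → Fin 6, Function.Surjective part ∧
    ∀ u v : V, u ≠ v → (G.Adj u v ↔ fatW5Rel (part u) (part v))

/-- `Gb` is a maximum spanning unit interval subgraph of `G`. -/
def IsMaxSpanningUIG {V : Type*} (G Gb : SimpleGraph V) : Prop :=
  Gb ≤ G ∧ Gb.IsUnitIntervalGraph ∧
    ∀ H : SimpleGraph V, H ≤ G → H.IsUnitIntervalGraph →
      H.edgeSet.ncard ≤ Gb.edgeSet.ncard

/-- `(Vm, Em, Ep)` is an editing set of `G`: `Em` is a set of edges of `G - Vm`,
`Ep` a set of non-edges of `G - Vm`, and deleting `Em` and adding `Ep` makes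
`G - Vm` a unit interval graph. -/
def IsEditingSet {V : Type*} (G : SimpleGraph V) (Vm : Set V) (Em Ep : Set (Sym2 V)) : Prop :=
  Em ⊆ G.edgeSet ∧ (∀ e ∈ Em, ∀ x ∈ e, x ∉ Vm) ∧
  (∀ e ∈ Ep, ¬ e.IsDiag ∧ e ∉ G.edgeSet ∧ ∀ x ∈ e, x ∉ Vm) ∧
  ((SimpleGraph.fromEdgeSet ((G.edgeSet \ Em) ∪ Ep)).induce {v | v ∉ Vm}).IsUnitIntervalGraph


/-- The minimum length `h(x)` of a hole of `G` through `x` (junk value `0` if none). -/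
noncomputable def holeDist {V : Type*} (G : SimpleGraph V) (x : V) : ℕ :=
  sInf {n | ∃ f : ZMod n → V, G.IsHoleOn n f ∧ ∃ j, f j = x}

namespace PreArcModel

variable {V : Type*}

/-- The left endpoint of the lift `x = (v, k)` of the arc of `v` to the real line. -/
noncomputable def lo (A : PreArcModel V) (x : V × ℤ) : ℝ := A.src x.1 + x.2 * A.L

/-- The right endpoint of the lift `x = (v, k)` of the arc of `v` to the real line. -/
noncomputable def hi (A : PreArcModel V) (x : V × ℤ) : ℝ := A.lo x + A.len x.1

/-- Two lifted arcs intersect. -/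
def Touch (A : PreArcModel V) (x y : V × ℤ) : Prop := A.lo x ≤ A.hi y ∧ A.lo y ≤ A.hi x

theorem Touch.symm {A : PreArcModel V} {x y : V × ℤ} (h : A.Touch x y) : A.Touch y x :=
  ⟨h.2, h.1⟩

theorem lo_lt_hi (A : PreArcModel V) (x : V × ℤ) : A.lo x < A.hi x := by
  have := A.len_pos x.1
  unfold hi; linarith

theorem hi_lt_lo_add (A : PreArcModel V) (x : V × ℤ) : A.hi x < A.lo x + A.L := by
  have := A.len_lt x.1
  unfold hi; linarith

theorem lo_shift (A : PreArcModel V) (v : V) (k m : ℤ) :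
    A.lo (v, k + m) = A.lo (v, k) + m * A.L := by
  simp only [lo]; push_cast; ring

theorem hi_shift (A : PreArcModel V) (v : V) (k m : ℤ) :
    A.hi (v, k + m) = A.hi (v, k) + m * A.L := by
  simp only [hi, lo]; push_cast; ring

theorem lo_eq_add (A : PreArcModel V) (v : V) (k m : ℤ) :
    A.lo (v, m) = A.lo (v, k) + ((m - k : ℤ) : ℝ) * A.L := by
  simp only [lo]; push_cast; ring

theorem hi_eq_add (A : PreArcModel V) (v : V) (k m : ℤ) :
    A.hi (v, m) = A.hi (v, k) + ((m - k : ℤ) : ℝ) * A.L := by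
  simp only [hi, lo]; push_cast; ring

theorem Touch.shift {A : PreArcModel V} {u v : V} {i j : ℤ} (h : A.Touch (u, i) (v, j)) (m : ℤ) :
    A.Touch (u, i + m) (v, j + m) := by
  obtain ⟨h1, h2⟩ := h
  constructor <;> rw [lo_shift, hi_shift] <;> linarith

theorem coe_eq_coe_iff (A : PreArcModel V) (s t : ℝ) :
    (s : AddCircle A.L) = (t : AddCircle A.L) ↔ ∃ k : ℤ, t = s + k * A.L := by
  rw [eq_comm, ← sub_eq_zero, ← AddCircle.coe_sub, AddCircle.coe_eq_zero_iff]
  simp only [zsmul_eq_mul]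
  constructor <;> rintro ⟨k, hk⟩ <;> exact ⟨k, by linarith⟩

theorem coe_mem_arc_iff (A : PreArcModel V) (t : ℝ) (v : V) :
    (t : AddCircle A.L) ∈ A.arc v ↔ ∃ k : ℤ, A.lo (v, k) ≤ t ∧ t ≤ A.hi (v, k) := by
  constructor
  · rintro ⟨s, hs, hst⟩
    obtain ⟨k, hk⟩ := (A.coe_eq_coe_iff s t).1 hst
    refine ⟨k, ?_, ?_⟩ <;> simp only [lo, hi] <;> linarith [hs.1, hs.2]
  · rintro ⟨k, h1, h2⟩
    simp only [lo, hi] at h1 h2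
    refine ⟨t - k * A.L, ⟨by linarith, by linarith⟩, ?_⟩
    exact (A.coe_eq_coe_iff _ _).2 ⟨k, by ring⟩

theorem coe_hi (A : PreArcModel V) (x : V × ℤ) : (A.hi x : AddCircle A.L) = A.cp x.1 :=
  ((A.coe_eq_coe_iff _ _).2 ⟨x.2, by simp only [hi, lo]; ring⟩).symm

theorem coe_lo (A : PreArcModel V) (x : V × ℤ) : (A.lo x : AddCircle A.L) = A.ccp x.1 :=
  ((A.coe_eq_coe_iff _ _).2 ⟨x.2, by simp only [lo]⟩).symm

theorem arc_inter_nonempty_iff (A : PreArcModel V) (x : V × ℤ) (v : V) :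
    (A.arc x.1 ∩ A.arc v).Nonempty ↔ ∃ k : ℤ, A.Touch x (v, k) := by
  constructor
  · rintro ⟨_, ⟨s, hs, rfl⟩, hv⟩
    obtain ⟨k, h1, h2⟩ := (A.coe_mem_arc_iff s v).1 hv
    refine ⟨k + x.2, ?_⟩
    have h3 : A.Touch (x.1, 0) (v, k) := by
      constructor <;> simp only [lo, hi] at * <;> push_cast <;> linarith [hs.1, hs.2]
    simpa using h3.shift x.2
  · rintro ⟨k, h1, h2⟩
    refine ⟨((max (A.lo x) (A.lo (v, k)) : ℝ) : AddCircle A.L), ?_, ?_⟩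
    · exact (A.coe_mem_arc_iff _ _).2 ⟨x.2, le_max_left _ _, max_le (A.lo_lt_hi x).le h2⟩
    · exact (A.coe_mem_arc_iff _ _).2 ⟨k, le_max_right _ _, max_le h1 (A.lo_lt_hi _).le⟩

theorem EndpointsDistinct.lo_injective {A : PreArcModel V} (hA : A.EndpointsDistinct) :
    Function.Injective A.lo := by
  intro x y h
  have h1 : A.ccp x.1 = A.ccp y.1 := by rw [← coe_lo, ← coe_lo, h]
  have h2 : ((x.1, false) : V × Bool) = (y.1, false) := hA (by simpa using h1)
  have h3 : x.1 = y.1 := congrArg (fun p : V × Bool => p.1) h2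
  have h4 : (x.2 : ℝ) = y.2 := by
    simp only [lo, h3] at h
    exact mul_right_cancel₀ A.L_pos.ne' (by linarith)
  exact Prod.ext h3 (by exact_mod_cast h4)

theorem Proper.hi_lt_hi {A : PreArcModel V} (hp : A.Proper) {x y : V × ℤ}
    (h : A.lo x < A.lo y) : A.hi x < A.hi y := by
  by_contra! hle
  refine hp y.1 x.1 ⟨?_, ?_⟩
  · rintro _ ⟨s, hs, rfl⟩
    have h1 : (s : AddCircle A.L) = ((s + y.2 * A.L : ℝ) : AddCircle A.L) :=
      (A.coe_eq_coe_iff _ _).2 ⟨y.2, rfl⟩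
    simp only
    rw [h1, coe_mem_arc_iff]
    refine ⟨x.2, ?_, ?_⟩ <;> simp only [lo, hi] at * <;> linarith [hs.1, hs.2]
  · intro hsub
    have h1 : (A.lo x : AddCircle A.L) ∈ A.arc y.1 :=
      hsub ((A.coe_mem_arc_iff _ _).2 ⟨x.2, le_rfl, (A.lo_lt_hi x).le⟩)
    obtain ⟨k, h2, h3⟩ := (A.coe_mem_arc_iff _ _).1 h1
    have h4 := A.hi_lt_lo_add x
    rw [A.lo_eq_add y.1 y.2 k] at h2
    rw [A.hi_eq_add y.1 y.2 k] at h3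
    have h5 := A.lo_lt_hi y
    have hL := A.L_pos
    change A.lo y + _ ≤ _ at h2
    change _ ≤ A.hi y + _ at h3
    rcases le_or_gt 0 (k - y.2) with h6 | h6
    · have : (0 : ℝ) ≤ ((k - y.2 : ℤ) : ℝ) := by exact_mod_cast h6
      nlinarith
    · have : ((k - y.2 : ℤ) : ℝ) ≤ -1 := by exact_mod_cast (by omega : k - y.2 ≤ -1)
      nlinarith

theorem Proper.hi_le_hi {A : PreArcModel V} (hA : A.EndpointsDistinct) (hp : A.Proper)
    {x y : V × ℤ} (h : A.lo x ≤ A.lo y) : A.hi x ≤ A.hi y := by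
  rcases h.lt_or_eq with h | h
  · exact (hp.hi_lt_hi h).le
  · rw [hA.lo_injective h]

theorem Proper.lo_lt_lo {A : PreArcModel V} (hA : A.EndpointsDistinct) (hp : A.Proper)
    {x y : V × ℤ} (h : A.hi x < A.hi y) : A.lo x < A.lo y := by
  by_contra! hle
  exact absurd (hp.hi_le_hi hA hle) (not_le.2 h)

theorem IsModelOf.adj_iff {A : PreArcModel V} {G : SimpleGraph V} (hm : A.IsModelOf G)
    (x : V × ℤ) (v : V) (hne : x.1 ≠ v) : G.Adj x.1 v ↔ ∃ k : ℤ, A.Touch x (v, k) := by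
  rw [hm.2 _ _ hne, arc_inter_nonempty_iff]

theorem IsModelOf.adj_of_touch {A : PreArcModel V} {G : SimpleGraph V} (hm : A.IsModelOf G)
    {x y : V × ℤ} (h : A.Touch x y) (hne : x.1 ≠ y.1) : G.Adj x.1 y.1 :=
  (hm.adj_iff x y.1 hne).2 ⟨y.2, h⟩

/-- If two lifts of one arc meet a lift of another, the two arcs cover the circle, so that the
former arc meets every arc. -/
theorem Proper.exists_touch_of_covering {A : PreArcModel V} (hp : A.Proper)
    {z : V × ℤ} {v : V} {a b : ℤ} (ha : A.Touch z (v, a)) (hb : A.Touch z (v, b))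
    (hab : a ≠ b) (w : V) (c : ℤ) : ∃ k : ℤ, A.Touch (v, c) (w, k) := by
  suffices H : ∀ a b : ℤ, A.Touch z (v, a) → A.Touch z (v, b) → a < b →
      ∃ k : ℤ, A.Touch (v, c) (w, k) by
    rcases hab.lt_or_gt with h | h
    exacts [H a b ha hb h, H b a hb ha h]
  intro a b ha hb hab
  obtain ⟨k, hk⟩ : ∃ k : ℤ, A.Touch (v, a) (w, k) := by
    set q := ⌊(A.hi (v, a) - A.src w) / A.L⌋ with hq
    have hL := A.L_pos
    have h1 : (q : ℝ) * A.L ≤ A.hi (v, a) - A.src w :=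
      (le_div_iff₀ hL).1 (Int.floor_le _)
    have h2 : A.hi (v, a) - A.src w < ((q : ℝ) + 1) * A.L :=
      (div_lt_iff₀ hL).1 (Int.lt_floor_add_one _)
    refine ⟨q, ?_, ?_⟩
    · by_contra! h3
      have h4 : A.lo (w, q + 1) = A.lo (w, q) + A.L := by rw [lo_shift]; simp
      have h5 : A.hi (w, q + 1) = A.hi (w, q) + A.L := by rw [hi_shift]; simp
      have h6 : A.lo (v, a) + A.L ≤ A.lo (v, b) := by
        rw [A.lo_eq_add v a b]
        have : (1 : ℝ) ≤ ((b - a : ℤ) : ℝ) := by exact_mod_cast (by omega : 1 ≤ b - a)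
        nlinarith
      have h7 : A.lo z < A.lo (w, q + 1) := by
        have : A.lo (w, q) = A.src w + q * A.L := rfl
        linarith [ha.1]
      have h8 := hp.hi_lt_hi h7
      linarith [hb.2]
    · simp only [lo] at *; linarith
  have := hk.shift (c - a)
  rw [show a + (c - a) = c by ring] at this
  exact ⟨_, this⟩

end PreArcModel

namespace SimpleGraph.IsHoleOn

variable {V : Type*} {G : SimpleGraph V} {n : ℕ} {f : ZMod n → V}

theorem natCast_ne_zero (hf : G.IsHoleOn n f) {m : ℕ} (h0 : 0 < m) (h4 : m < 4) :
    (m : ZMod n) ≠ 0 := by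
  rw [Ne, ZMod.natCast_eq_zero_iff]
  intro h
  have := Nat.le_of_dvd h0 h
  have := hf.1
  omega

theorem adj_succ (hf : G.IsHoleOn n f) (i : ZMod n) : G.Adj (f i) (f (i + 1)) :=
  (hf.2.2 _ _).2 (Or.inr rfl)

theorem ne_add_two (hf : G.IsHoleOn n f) (i : ZMod n) : f i ≠ f (i + 2) := by
  intro h
  have h1 := hf.2.1 h
  apply hf.natCast_ne_zero (m := 2) (by norm_num) (by norm_num)
  push_cast
  linear_combination -h1

theorem not_adj_add_two (hf : G.IsHoleOn n f) (i : ZMod n) : ¬ G.Adj (f i) (f (i + 2)) := by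
  rw [hf.2.2]
  rintro (h | h)
  · apply hf.natCast_ne_zero (m := 3) (by norm_num) (by norm_num)
    push_cast
    linear_combination -h
  · apply hf.natCast_ne_zero (m := 1) (by norm_num) (by norm_num)
    push_cast
    linear_combination h

theorem comp_add (hf : G.IsHoleOn n f) (c : ZMod n) : G.IsHoleOn n (fun i => f (c + i)) := by
  refine ⟨hf.1, fun i j h => add_left_cancel (hf.2.1 h), fun i j => ?_⟩
  simp only [hf.2.2, add_assoc, add_right_inj]

theorem comp_neg (hf : G.IsHoleOn n f) : G.IsHoleOn n (fun i => f (-i)) := by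
  refine ⟨hf.1, fun i j h => neg_injective (hf.2.1 h), fun i j => ?_⟩
  rw [hf.2.2, or_comm]
  refine or_congr ⟨fun h => ?_, fun h => ?_⟩ ⟨fun h => ?_, fun h => ?_⟩
  · linear_combination h
  · linear_combination h
  · linear_combination h
  · linear_combination h

end SimpleGraph.IsHoleOn

namespace PreArcModel

variable {V : Type*} {A : PreArcModel V} {G : SimpleGraph V}

/-- In a proper Helly model of a non-chordal graph no two arcs cover the circle: a lifted arc
meets at most one lift of any arc. -/
theorem Helly.touch_unique (hH : A.Helly) (hm : A.IsModelOf G) (hp : A.Proper)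
    (hole : G.HasHole) {z : V × ℤ} {v : V} {a b : ℤ}
    (ha : A.Touch z (v, a)) (hb : A.Touch z (v, b)) : a = b := by
  obtain ⟨n, f, hf⟩ := hole
  have hn : NeZero n := ⟨by have := hf.1; omega⟩
  have uniq : ∀ (i : ZMod n) (x : V × ℤ) (c d : ℤ), A.Touch x (f i, c) → A.Touch x (f i, d) →
      c = d := by
    intro i x c d hc hd
    by_contra hcd
    obtain ⟨k, hk⟩ := hp.exists_touch_of_covering hc hd hcd (f (i + 2)) 0
    exact hf.not_adj_add_two i (hm.adj_of_touch hk (hf.ne_add_two i))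
  by_contra hab
  have univ := hp.exists_touch_of_covering ha hb hab
  choose F hF using fun i : ZMod n => univ (f i) 0
  have cons : ∀ i, A.Touch (f i, F i) (f (i + 1), F (i + 1)) := by
    intro i
    have hinter : ∀ x y : V × ℤ, A.Touch x y → (A.arc x.1 ∩ A.arc y.1).Nonempty :=
      fun x y h => (A.arc_inter_nonempty_iff x y.1).2 ⟨y.2, h⟩
    have hself : ∀ u : V, (A.arc u ∩ A.arc u).Nonempty := fun u =>
      hinter (u, 0) (u, 0) ⟨(A.lo_lt_hi _).le, (A.lo_lt_hi _).le⟩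
    have e1 : (A.arc v ∩ A.arc (f i)).Nonempty := hinter _ _ (hF i)
    have e2 : (A.arc v ∩ A.arc (f (i + 1))).Nonempty := hinter _ _ (hF (i + 1))
    have e3 : (A.arc (f i) ∩ A.arc (f (i + 1))).Nonempty :=
      (hm.2 _ _ (hf.adj_succ i).ne).1 (hf.adj_succ i)
    obtain ⟨t, ht⟩ := hH {v, f i, f (i + 1)} (by
      rintro x (rfl | rfl | rfl) y (rfl | rfl | rfl)
      all_goals first
        | exact hself _
        | assumption
        | (rw [Set.inter_comm]; assumption))
    obtain ⟨s, rfl⟩ := QuotientAddGroup.mk_surjective t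
    simp only [Set.mem_iInter] at ht
    obtain ⟨c0, h01, h02⟩ := (A.coe_mem_arc_iff s v).1 (ht v (by simp))
    obtain ⟨c1, h11, h12⟩ := (A.coe_mem_arc_iff s (f i)).1 (ht _ (by simp))
    obtain ⟨c2, h21, h22⟩ := (A.coe_mem_arc_iff s (f (i + 1))).1 (ht _ (by simp))
    have t1 : A.Touch (v, c0) (f i, c1) := ⟨h01.trans h12, h11.trans h02⟩
    have t2 : A.Touch (v, c0) (f (i + 1), c2) := ⟨h01.trans h22, h21.trans h02⟩
    have t3 : A.Touch (f i, c1) (f (i + 1), c2) := ⟨h11.trans h22, h21.trans h12⟩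
    have u1 := uniq i _ _ _ (by simpa using t1.shift (-c0)) (hF i)
    have u2 := uniq (i + 1) _ _ _ (by simpa using t2.shift (-c0)) (hF (i + 1))
    have := t3.shift (-c0)
    rwa [u1, u2] at this
  obtain ⟨i, hi⟩ := Finite.exists_min (fun i : ZMod n => A.hi (f i, F i))
  have h1 := cons i
  have h2 := cons (i - 1)
  have h3 := hi (i + 1)
  have h4 := hi (i - 1)
  rw [sub_add_cancel] at h2
  have h5 : A.Touch (f (i - 1), F (i - 1)) (f (i + 1), F (i + 1)) :=
    ⟨h2.1.trans h3, h1.2.trans h4⟩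
  have e : i + 1 = i - 1 + 2 := by ring
  rw [e] at h5
  exact hf.not_adj_add_two _ (hm.adj_of_touch h5 (hf.ne_add_two _))

/-- In a proper Helly model of a non-chordal graph no three arcs cover the circle. -/
theorem Helly.not_three_cover (hH : A.Helly) (hm : A.IsModelOf G) (hp : A.Proper)
    (hole : G.HasHole) {x y z : V × ℤ} (hxy : A.Touch x y) (hyz : A.Touch y z)
    (hzx : A.Touch z (x.1, x.2 + 1)) : False := by
  have uniq := fun {z : V × ℤ} {v : V} {a b : ℤ} => hH.touch_unique hm hp hole (z := z) (v := v)
    (a := a) (b := b)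
  have hinter : ∀ x y : V × ℤ, A.Touch x y → (A.arc x.1 ∩ A.arc y.1).Nonempty :=
    fun x y h => (A.arc_inter_nonempty_iff x y.1).2 ⟨y.2, h⟩
  have hself : ∀ u : V, (A.arc u ∩ A.arc u).Nonempty := fun u =>
    hinter (u, 0) (u, 0) ⟨(A.lo_lt_hi _).le, (A.lo_lt_hi _).le⟩
  have e1 := hinter _ _ hxy
  have e2 := hinter _ _ hyz
  have e3 := hinter _ _ hzx
  simp only at e3
  obtain ⟨t, ht⟩ := hH {x.1, y.1, z.1} (by
    rintro u (rfl | rfl | rfl) w (rfl | rfl | rfl)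
    all_goals first
      | exact hself _
      | assumption
      | (rw [Set.inter_comm]; assumption))
  obtain ⟨s, rfl⟩ := QuotientAddGroup.mk_surjective t
  simp only [Set.mem_iInter] at ht
  obtain ⟨c0, h01, h02⟩ := (A.coe_mem_arc_iff s x.1).1 (ht _ (by simp))
  obtain ⟨c1, h11, h12⟩ := (A.coe_mem_arc_iff s y.1).1 (ht _ (by simp))
  obtain ⟨c2, h21, h22⟩ := (A.coe_mem_arc_iff s z.1).1 (ht _ (by simp))
  have t1 : A.Touch (x.1, c0) (y.1, c1) := ⟨h01.trans h12, h11.trans h02⟩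
  have t2 : A.Touch (x.1, c0) (z.1, c2) := ⟨h01.trans h22, h21.trans h02⟩
  have t3 : A.Touch (y.1, c1) (z.1, c2) := ⟨h11.trans h22, h21.trans h12⟩
  have s1 := t1.shift (x.2 - c0)
  have s2 := t2.shift (x.2 - c0)
  have s3 := t3.shift (x.2 - c0)
  rw [add_sub_cancel] at s1 s2
  have u1 : c1 + (x.2 - c0) = y.2 := uniq s1 hxy
  rw [u1] at s3
  have u2 : c2 + (x.2 - c0) = z.2 := uniq s3 hyz
  rw [u2] at s2
  have := uniq s2.symm hzx
  omega

/-- The clockwise traversal of a hole lifts to an increasing chain on the real line. -/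
theorem exists_increasing_lift (hm : A.IsModelOf G) {n : ℕ} {f : ZMod n → V}
    (hf : G.IsHoleOn n f) :
    ∃ Y : ℕ → V × ℤ, Y 0 = (f 0, 0) ∧ (∀ i, A.lo (Y i) < A.lo (Y (i + 1))) ∧
      (∀ i, A.lo (Y (i + 1)) ≤ A.hi (Y i)) ∧ (Y n).1 = f 0 ∧
      (Y (n - 1)).1 ≠ (Y 1).1 ∧ ¬ G.Adj (Y (n - 1)).1 (Y 1).1 := by
  have key : ∀ f : ZMod n → V, G.IsHoleOn n f →
      (∃ k : ℤ, A.Touch (f 0, 0) (f 1, k) ∧ A.lo (f 0, 0) < A.lo (f 1, k)) →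
      ∃ Y : ℕ → V × ℤ, Y 0 = (f 0, 0) ∧ (∀ i, A.lo (Y i) < A.lo (Y (i + 1))) ∧
      (∀ i, A.lo (Y (i + 1)) ≤ A.hi (Y i)) ∧ (Y n).1 = f 0 ∧
      (Y (n - 1)).1 ≠ (Y 1).1 ∧ ¬ G.Adj (Y (n - 1)).1 (Y 1).1 := by
    rintro f hf ⟨k, hk, hlt⟩
    have ex : ∀ (i : ℕ) (m : ℤ), ∃ m' : ℤ, A.Touch (f i, m) (f ((i + 1 : ℕ)), m') ∧
        (i = 0 → m = 0 → m' = k) := by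
      intro i m
      by_cases h : i = 0 ∧ m = 0
      · obtain ⟨rfl, rfl⟩ := h
        exact ⟨k, by simpa using hk, fun _ _ => rfl⟩
      · obtain ⟨m', hm'⟩ := (hm.adj_iff (f i, m) (f ((i + 1 : ℕ)))
          (by simpa using (hf.adj_succ i).ne)).1 (by simpa using hf.adj_succ i)
        exact ⟨m', hm', fun h1 h2 => absurd ⟨h1, h2⟩ h⟩
    choose s hs hs0 using ex
    let c : ℕ → ℤ := fun i => Nat.rec 0 (fun i m => s i m) i
    have hc0 : c 0 = 0 := rfl
    have hc : ∀ i : ℕ, A.Touch (f i, c i) (f ((i + 1 : ℕ)), c (i + 1)) := fun i => hs i (c i)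
    have hc1 : c 1 = k := hs0 0 (c 0) rfl rfl
    have hinc : ∀ i : ℕ, A.lo (f i, c i) < A.lo (f ((i + 1 : ℕ)), c (i + 1)) := by
      intro i
      induction i with
      | zero => simpa [hc0, hc1] using hlt
      | succ i ih =>
        by_contra! hle
        have h5 : A.Touch (f i, c i) (f ((i + 1 + 1 : ℕ)), c (i + 1 + 1)) :=
          ⟨ih.le.trans (hc (i + 1)).1, hle.trans (hc i).2⟩
        have e : ((i + 1 + 1 : ℕ) : ZMod n) = i + 2 := by push_cast; ring
        rw [e] at h5
        exact hf.not_adj_add_two _ (hm.adj_of_touch h5 (hf.ne_add_two _))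
    have hn := hf.1
    have e1 : ((1 : ℕ) : ZMod n) = ((n - 1 : ℕ) : ZMod n) + 2 := by
      rw [Nat.cast_sub (by omega)]; simp; ring
    refine ⟨fun i => (f i, c i), by simp [hc0], hinc, fun i => (hc i).2, by simp, ?_, ?_⟩
    · simp only [e1]; exact hf.ne_add_two _
    · simp only [e1]; exact hf.not_adj_add_two _
  obtain ⟨k, hk⟩ := (hm.adj_iff (f 0, 0) (f 1) (by simpa using (hf.adj_succ 0).ne)).1
    (by simpa using hf.adj_succ 0)
  rcases lt_or_ge (A.lo (f 0, 0)) (A.lo (f 1, k)) with h | h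
  · exact key f hf ⟨k, hk, h⟩
  · have hf' := hf.comp_neg
    obtain ⟨j, hj⟩ := (hm.adj_iff (f 0, 0) (f (-1)) (by simpa using (hf'.adj_succ 0).ne)).1
      (by simpa using hf'.adj_succ 0)
    have := key _ hf' ⟨j, by simpa using hj, by
      by_contra! h'
      rw [neg_zero] at h'
      have h5 : A.Touch (f (-1), j) (f 1, k) := ⟨h'.trans hk.1, h.trans hj.1⟩
      have h6 : A.Touch (f (-1), j) (f (-1 + 2), k) := by
        rwa [show (-1 + 2 : ZMod n) = 1 by ring]
      exact hf.not_adj_add_two _ (hm.adj_of_touch h6 (hf.ne_add_two _))⟩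
    simpa using this

/-- Every lifted arc `x` has a rightmost lifted arc whose left endpoint is not beyond `x`. -/
theorem exists_rightmost [Finite V] (A : PreArcModel V) (x : V × ℤ) :
    ∃ y : V × ℤ, A.lo y ≤ A.hi x ∧ ∀ z : V × ℤ, A.lo z ≤ A.hi x → A.lo z ≤ A.lo y := by
  have hL := A.L_pos
  have : Nonempty V := ⟨x.1⟩
  let q : V → ℤ := fun w => ⌊(A.hi x - A.src w) / A.L⌋
  have hq : ∀ (w : V) (k : ℤ), A.lo (w, k) ≤ A.hi x ↔ k ≤ q w := by
    intro w k
    rw [Int.le_floor, le_div_iff₀ hL]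
    simp only [lo]
    constructor <;> intro h <;> linarith
  obtain ⟨w, hw⟩ := Finite.exists_max (fun w => A.lo (w, q w))
  refine ⟨(w, q w), (hq _ _).2 le_rfl, fun z hz => le_trans ?_ (hw z.1)⟩
  have h1 : (z.2 : ℝ) ≤ q z.1 := by exact_mod_cast (hq z.1 z.2).1 hz
  simp only [lo]
  nlinarith

/-- The greedy choice of the rightmost arc on the circle is the greedy choice of lifted arcs. -/
theorem Helly.eq_rightmost (hH : A.Helly) (hm : A.IsModelOf G) (hp : A.Proper)
    (hole : G.HasHole) {x y : V × ℤ} (hy : A.lo y ≤ A.hi x)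
    (hmax : ∀ z : V × ℤ, A.lo z ≤ A.hi x → A.lo z ≤ A.lo y) {w : V}
    (hw : A.cp x.1 ∈ A.arc w)
    (hright : ∀ u : V, u ≠ w → A.cp x.1 ∈ A.arc u → A.cp u ∈ A.arc w) : w = y.1 := by
  by_contra hne
  rw [← coe_hi, coe_mem_arc_iff] at hw
  obtain ⟨k, hk1, hk2⟩ := hw
  have h1 := hmax _ hk1
  have h2 : A.lo (w, k) < A.lo y := lt_of_le_of_ne h1 fun h =>
    hne (congrArg Prod.fst (hm.1.lo_injective h))
  have h3 := hp.hi_lt_hi h2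
  have h4 := hright y.1 (Ne.symm hne)
    (by rw [← coe_hi, coe_mem_arc_iff]; exact ⟨y.2, hy, hk2.trans h3.le⟩)
  rw [← coe_hi, coe_mem_arc_iff] at h4
  obtain ⟨m, hm1, hm2⟩ := h4
  have t1 : A.Touch y (w, k) := ⟨hy.trans hk2, h1.trans (A.lo_lt_hi y).le⟩
  have t2 : A.Touch y (w, m) := ⟨(A.lo_lt_hi y).le.trans hm2, hm1⟩
  rw [hH.touch_unique hm hp hole t1 t2] at h3
  exact absurd hm2 (not_le.2 h3)

end PreArcModel

theorem ZMod.eq_add_one_iff_val {k : ℕ} (hk : 1 < k) (i j : ZMod k) :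
    j = i + 1 ↔ j.val = i.val + 1 ∨ (i.val = k - 1 ∧ j.val = 0) := by
  have : NeZero k := ⟨by omega⟩
  have : Fact (1 < k) := ⟨hk⟩
  have hi := i.val_lt
  have hj := j.val_lt
  rw [← (ZMod.val_injective k).eq_iff, ZMod.val_add, ZMod.val_one]
  rcases Nat.lt_or_ge (i.val + 1) k with h | h
  · rw [Nat.mod_eq_of_lt h]; omega
  · rw [show i.val + 1 = k by omega, Nat.mod_self]; omega

namespace PreArcModel

variable {V : Type*} {A : PreArcModel V} {G : SimpleGraph V}

/-- A chain of lifted arcs winding once around the circle without chords is a hole. -/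
theorem isHoleOn_of_chain (hm : A.IsModelOf G) {k : ℕ} (hk : 4 ≤ k) (X : ℕ → V × ℤ)
    (hinc : ∀ i j, i < j → j < k → A.lo (X i) < A.lo (X j))
    (hlt : ∀ i < k, A.lo (X i) < A.lo (X 0) + A.L)
    (hstep : ∀ i, i + 1 < k → A.lo (X (i + 1)) ≤ A.hi (X i))
    (hclose : A.lo (X 0) + A.L ≤ A.hi (X (k - 1)))
    (hchord : ∀ i j, i + 2 ≤ j → j < k → A.hi (X i) < A.lo (X j))
    (hwrap : ∀ i j, i < j → j < k → (i ≠ 0 ∨ j ≠ k - 1) → A.hi (X j) < A.lo (X i) + A.L) :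
    G.IsHoleOn k (fun i => (X i.val).1) := by
  have hL := A.L_pos
  have : NeZero k := ⟨by omega⟩
  have hmono : ∀ i < k, A.lo (X 0) ≤ A.lo (X i) := by
    intro i hi
    rcases Nat.eq_zero_or_pos i with rfl | h
    exacts [le_rfl, (hinc 0 i h hi).le]
  have touch : ∀ i j, i < j → j < k → ∀ m : ℤ, A.Touch (X i) ((X j).1, (X j).2 + m) →
      (m = 0 ∧ j = i + 1) ∨ (m = -1 ∧ i = 0 ∧ j = k - 1) := by
    intro i j hij hj m ht
    obtain ⟨h1, h2⟩ := ht
    rw [hi_shift] at h1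
    rw [lo_shift] at h2
    change A.lo (X i) ≤ A.hi (X j) + _ at h1
    change A.lo (X j) + _ ≤ A.hi (X i) at h2
    have h3 := A.hi_lt_lo_add (X i)
    have h4 := A.hi_lt_lo_add (X j)
    have h5 := hinc i j hij hj
    have h6 := hmono i (by omega)
    have h7 := hlt j hj
    have hm1 : ¬ 1 ≤ m := by
      intro h
      have : (1 : ℝ) ≤ m := by exact_mod_cast h
      nlinarith
    have hm2 : ¬ m ≤ -2 := by
      intro h
      have : (m : ℝ) ≤ -2 := by exact_mod_cast h
      nlinarith
    obtain rfl | rfl : m = 0 ∨ m = -1 := by omega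
    · left
      refine ⟨rfl, ?_⟩
      by_contra hne
      have := hchord i j (by omega) hj
      simp at h2
      linarith
    · right
      refine ⟨rfl, ?_⟩
      by_contra hne
      have := hwrap i j hij hj (by omega)
      push_cast at h1
      linarith
  have hne : ∀ i j, i < j → j < k → (X i).1 ≠ (X j).1 := by
    intro i j hij hj h
    have e : X i = ((X j).1, (X j).2 + ((X i).2 - (X j).2)) := Prod.ext h (by simp)
    have hlo : A.lo (X i) = A.lo (X j) + (((X i).2 - (X j).2 : ℤ) : ℝ) * A.L := by
      conv_lhs => rw [e]
      rw [lo_shift]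
    have h5 := hinc i j hij hj
    have h6 := hmono i (by omega)
    have h7 := hlt j hj
    have := touch i j hij hj ((X i).2 - (X j).2) (by
      rw [← e]; exact ⟨(A.lo_lt_hi _).le, (A.lo_lt_hi _).le⟩)
    rcases this with ⟨h8, -⟩ | ⟨h8, -⟩
    · rw [h8] at hlo; push_cast at hlo; linarith
    · rw [h8] at hlo; push_cast at hlo; linarith
  have hadj : ∀ i j, i < j → j < k →
      (G.Adj (X i).1 (X j).1 ↔ j = i + 1 ∨ (i = 0 ∧ j = k - 1)) := by
    intro i j hij hj
    rw [hm.adj_iff (X i) _ (hne i j hij hj)]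
    constructor
    · rintro ⟨c, hc⟩
      have := touch i j hij hj (c - (X j).2) (by simpa using hc)
      tauto
    · rintro (rfl | ⟨rfl, rfl⟩)
      · exact ⟨(X (i + 1)).2, (hinc _ _ hij hj).le.trans (A.lo_lt_hi _).le, hstep i hj⟩
      · refine ⟨(X (k - 1)).2 + (-1), ?_, ?_⟩
        · rw [hi_shift]; push_cast
          change _ ≤ A.hi (X (k - 1)) + _
          linarith
        · rw [lo_shift]; push_cast
          change A.lo (X (k - 1)) + _ ≤ _
          linarith [hlt _ hj, A.lo_lt_hi (X 0)]
  refine ⟨hk, fun i j h => ?_, fun i j => ?_⟩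
  · by_contra hij
    have hv : i.val ≠ j.val := fun h => hij (ZMod.val_injective k h)
    rcases hv.lt_or_gt with h' | h'
    · exact hne _ _ h' j.val_lt h
    · exact hne _ _ h' i.val_lt h.symm
  · rw [ZMod.eq_add_one_iff_val (by omega), ZMod.eq_add_one_iff_val (by omega)]
    have hi := i.val_lt
    have hj := j.val_lt
    rcases lt_trichotomy i.val j.val with h | h | h
    · rw [hadj _ _ h hj]; omega
    · have : ¬ G.Adj (X i.val).1 (X j.val).1 := by rw [h]; exact G.loopless.irrefl _
      simp only [this, false_iff]; omega
    · rw [G.adj_comm, hadj _ _ h hi]; omega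

/-- The greedy chain starting at a vertex of a hole of length `n` closes up to a hole of length
at most `n`; only its last vertex is possibly not the greedy choice. -/
theorem Helly.exists_greedy_hole (hH : A.Helly) (hm : A.IsModelOf G) (hp : A.Proper)
    {n : ℕ} {f : ZMod n → V} (hf : G.IsHoleOn n f) {g : V × ℤ → V × ℤ}
    (hg : ∀ x, A.lo (g x) ≤ A.hi x) (hmax : ∀ x z, A.lo z ≤ A.hi x → A.lo z ≤ A.lo (g x)) :
    ∃ k ≤ n, ∃ X : ℕ → V × ℤ, G.IsHoleOn k (fun i : ZMod k => (X i.val).1) ∧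
      (∀ i, i + 1 < k → X i = g^[i] (f 0, 0)) ∧
      G.Adj (g^[k - 1] (f 0, 0)).1 (f 0) := by
  have hL := A.L_pos
  have hole : G.HasHole := ⟨n, f, hf⟩
  have hn := hf.1
  have uniq := fun {z : V × ℤ} {v : V} {a b : ℤ} => hH.touch_unique hm hp hole (z := z) (v := v)
    (a := a) (b := b)
  obtain ⟨Y, hY0, hYinc, hYstep, hYn, hYne, hYadj⟩ := exists_increasing_lift hm hf
  set x₀ : V × ℤ := (f 0, 0) with hx₀
  let x₁ : V × ℤ := (f 0, 0 + 1)
  have lx₁ : A.lo x₁ = A.lo x₀ + A.L := by rw [lo_shift]; simp [hx₀]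
  have gle : ∀ x, A.lo x ≤ A.lo (g x) := fun x => hmax x x (A.lo_lt_hi x).le
  have gmono : ∀ {x y}, A.lo x ≤ A.lo y → A.lo (g x) ≤ A.lo (g y) := fun h =>
    hmax _ _ ((hg _).trans (hp.hi_le_hi hm.1 h))
  have giter : ∀ i, g^[i + 1] x₀ = g (g^[i] x₀) := fun i => Function.iterate_succ_apply' g i x₀
  have gmonoi : Monotone (fun i => A.lo (g^[i] x₀)) :=
    monotone_nat_of_le_succ fun i => by simp only [giter]; exact gle _
  have Ymono : StrictMono (fun i => A.lo (Y i)) := strictMono_nat_of_lt_succ hYinc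
  have dom : ∀ i, A.lo (Y i) ≤ A.lo (g^[i] x₀) := by
    intro i
    induction i with
    | zero => rw [hY0]; exact le_rfl
    | succ i ih =>
      rw [giter]
      exact hmax _ _ ((hYstep i).trans (hp.hi_le_hi hm.1 ih))
  obtain ⟨m, hm1, hYm⟩ : ∃ m : ℤ, 1 ≤ m ∧ A.lo (Y n) = A.lo x₀ + m * A.L := by
    have e : A.lo (Y n) = A.lo x₀ + (Y n).2 * A.L := by simp [lo, hYn, hx₀]
    refine ⟨(Y n).2, ?_, e⟩
    have h1 := Ymono (show 0 < n by omega)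
    simp only [hY0, e] at h1
    by_contra! h
    have : ((Y n).2 : ℝ) ≤ 0 := by exact_mod_cast (by omega : (Y n).2 ≤ 0)
    nlinarith
  have hm1' : (1 : ℝ) ≤ m := by exact_mod_cast hm1
  have ex : ∃ k, A.lo x₀ + A.L ≤ A.lo (g^[k] x₀) := ⟨n, by have := dom n; nlinarith⟩
  classical
  obtain ⟨k, hkspec, hkmin⟩ : ∃ k, A.lo x₀ + A.L ≤ A.lo (g^[k] x₀) ∧
      ∀ i < k, A.lo (g^[i] x₀) < A.lo x₀ + A.L :=
    ⟨Nat.find ex, Nat.find_spec ex, fun i hi => not_le.1 (Nat.find_min ex hi)⟩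
  have hkn : k ≤ n := by
    by_contra! h
    have := hkmin n h
    have := dom n
    nlinarith
  have himin : ∀ i, i + 1 < k → A.hi (g^[i] x₀) < A.lo x₀ + A.L := by
    intro i hi
    by_contra! h
    rw [← lx₁] at h
    have h1 := hmax _ _ h
    rw [← giter, lx₁] at h1
    exact absurd h1 (not_le.2 (hkmin _ hi))
  have strict : ∀ i < k, A.lo (g^[i] x₀) < A.lo (g^[i + 1] x₀) := by
    intro i hi
    refine lt_of_le_of_ne (gmonoi i.le_succ) fun h => ?_
    have hfix : g (g^[i] x₀) = g^[i] x₀ := by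
      rw [← giter]; exact (hm.1.lo_injective h).symm
    have : g^[k] x₀ = g^[i] x₀ := by
      obtain ⟨d, rfl⟩ := Nat.exists_eq_add_of_lt hi
      rw [show i + d + 1 = (d + 1) + i by ring, Function.iterate_add_apply,
        Function.iterate_fixed hfix]
    rw [this] at hkspec
    exact absurd hkspec (not_le.2 (hkmin i hi))
  have gtouch : ∀ x, A.Touch x (g x) := fun x => ⟨(gle x).trans (A.lo_lt_hi _).le, hg x⟩
  have hk0 : k ≠ 0 := by
    rintro rfl
    simp at hkspec; linarith
  have lastTouch : A.Touch (g^[k - 1] x₀) x₁ := by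
    have h1 := hkmin (k - 1) (by omega)
    have h2 := hg (g^[k - 1] x₀)
    rw [← giter, Nat.sub_add_cancel (by omega)] at h2
    exact ⟨by linarith [A.lo_lt_hi x₁], by linarith⟩
  have hk4 : 4 ≤ k := by
    by_contra! h
    have hc : k = 1 ∨ k = 2 ∨ k = 3 := by omega
    rcases hc with rfl | rfl | rfl
    · have := lastTouch.2
      have := A.hi_lt_lo_add x₀
      simp only [Nat.sub_self, Function.iterate_zero, id] at *
      linarith
    · have := uniq (gtouch x₀).symm lastTouch
      omega
    · exact hH.not_three_cover hm hp hole (gtouch x₀) (gtouch (g x₀)) lastTouch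
  let b : V × ℤ := ((Y (n - 1)).1, (Y (n - 1)).2 + (1 - m))
  have lb : A.lo b = A.lo (Y (n - 1)) + (1 - m) * A.L := by
    simp only [b, lo_shift]; push_cast; rfl
  have hb : A.hi b = A.hi (Y (n - 1)) + (1 - m) * A.L := by
    simp only [b, hi_shift]; push_cast; rfl
  have hYlast : A.lo (Y (n - 1)) < A.lo (Y n) := Ymono (by omega)
  have hYlast' : A.lo (Y n) ≤ A.hi (Y (n - 1)) := by
    have := hYstep (n - 1)
    rwa [Nat.sub_add_cancel (by omega)] at this
  have b_lt : A.lo b < A.lo x₀ + A.L := by rw [lb]; linarith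
  have b_ge : A.lo x₀ + A.L ≤ A.hi b := by rw [hb]; linarith
  have b_far : A.hi b < A.lo (g^[1] x₀) + A.L := by
    have h1 := dom 1
    suffices h : A.hi b < A.lo (Y 1) + A.L by linarith
    by_contra! h
    let a : V × ℤ := ((Y 1).1, (Y 1).2 + 1)
    have la : A.lo a = A.lo (Y 1) + A.L := by simp only [a, lo_shift]; simp
    have h2 := hYinc 0
    rw [hY0] at h2
    have h3 := A.lo_lt_hi a
    exact hYadj (hm.adj_of_touch (x := b) (y := a) ⟨by simp only [zero_add] at h2; linarith,
      by linarith⟩ hYne)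
  obtain ⟨z, hz_lt, hz_ge, hz_far, hz_g⟩ : ∃ z, A.lo z < A.lo x₀ + A.L ∧
      A.lo x₀ + A.L ≤ A.hi z ∧ A.hi z < A.lo (g^[1] x₀) + A.L ∧
      A.lo z ≤ A.lo (g^[k - 1] x₀) := by
    rcases le_total (A.lo b) (A.lo (g^[k - 1] x₀)) with h | h
    · exact ⟨b, b_lt, b_ge, b_far, h⟩
    · exact ⟨g^[k - 1] x₀, hkmin _ (by omega), lx₁ ▸ lastTouch.2,
        (hp.hi_le_hi hm.1 h).trans_lt b_far, le_rfl⟩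
  have gstrict : ∀ i j, i < j → j < k → A.lo (g^[i] x₀) < A.lo (g^[j] x₀) := fun i j hij hj =>
    (strict i (by omega)).trans_le (gmonoi hij)
  have hz_gt : ∀ i, i + 1 < k → A.lo (g^[i] x₀) < A.lo z := fun i hi =>
    hp.lo_lt_lo hm.1 ((himin i hi).trans_le hz_ge)
  have hchord : ∀ i, ∀ w, A.lo (g^[i + 1] x₀) < A.lo w → A.hi (g^[i] x₀) < A.lo w := by
    intro i w hw
    by_contra! h
    rw [giter] at hw
    exact absurd (hmax _ _ h) (not_le.2 hw)
  let X : ℕ → V × ℤ := fun i => if i + 1 < k then g^[i] x₀ else z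
  have hX : ∀ i, i + 1 < k → X i = g^[i] x₀ := fun i hi => if_pos hi
  have hXz : X (k - 1) = z := if_neg (by omega)
  have hX0 : X 0 = x₀ := hX 0 (by omega)
  refine ⟨k, hkn, X, isHoleOn_of_chain hm hk4 X ?_ ?_ ?_ ?_ ?_ ?_, hX, ?_⟩
  · intro i j hij hj
    rw [hX i (by omega)]
    rcases Nat.lt_or_ge (j + 1) k with h | h
    · rw [hX j h]; exact gstrict i j hij hj
    · rw [show j = k - 1 by omega, hXz]; exact hz_gt i (by omega)
  · intro i hi
    rw [hX0]
    rcases Nat.lt_or_ge (i + 1) k with h | h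
    · rw [hX i h]; exact hkmin i hi
    · rw [show i = k - 1 by omega, hXz]; exact hz_lt
  · intro i hi
    rw [hX i hi]
    have h1 := hg (g^[i] x₀)
    rw [← giter] at h1
    rcases Nat.lt_or_ge (i + 1 + 1) k with h | h
    · rw [hX _ h]; exact h1
    · rw [show i + 1 = k - 1 by omega] at h1 ⊢
      rw [hXz]; exact hz_g.trans h1
  · rw [hX0, hXz]; exact hz_ge
  · intro i j hij hj
    rw [hX i (by omega)]
    apply hchord
    rcases Nat.lt_or_ge (j + 1) k with h | h
    · rw [hX j h]; exact gstrict _ _ (by omega) hj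
    · rw [show j = k - 1 by omega, hXz]; exact hz_gt _ (by omega)
  · intro i j hij hj hor
    rw [hX i (by omega)]
    rcases Nat.lt_or_ge (j + 1) k with h | h
    · rw [hX j h]
      have h1 := gmonoi (Nat.zero_le i)
      have h2 := himin j h
      simp only [Function.iterate_zero, id] at h1
      linarith
    · rw [show j = k - 1 by omega, hXz]
      have h1 := gmonoi (show 1 ≤ i by omega)
      simp only at h1
      linarith
  · have hne : (g^[k - 1] x₀).1 ≠ f 0 := by
      intro h
      have e : g^[k - 1] x₀ = (f 0, (g^[k - 1] x₀).2) := Prod.ext h rfl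
      have h1 : A.Touch (g^[k - 1] x₀) (f 0, (g^[k - 1] x₀).2) := by
        rw [← e]; exact ⟨(A.lo_lt_hi _).le, (A.lo_lt_hi _).le⟩
      have h2 := uniq h1 lastTouch
      rw [h2] at e
      have h3 := hkmin (k - 1) (by omega)
      rw [e, ← lx₁] at h3
      exact lt_irrefl _ h3
    exact hm.adj_of_touch lastTouch hne

end PreArcModel

/-- Greedily extending to the rightmost arcs stays on a shortest hole
through the starting vertex. -/
theorem stmt6 {V : Type*} [Fintype V] (G : SimpleGraph V) (A : PreArcModel V)
    (hm : A.IsModelOf G) (hproper : A.Proper) (hhelly : A.Helly) (hnc : ¬ G.Chordal)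
    (p : ℕ) (hp : 0 < p) (v : Fin p → V)
    (hright : ∀ i : Fin p, 1 ≤ i.val →
      (A.cp (v ⟨i.val - 1, Nat.lt_of_le_of_lt (Nat.sub_le _ _) i.isLt⟩) ∈ A.arc (v i) ∧
       ∀ u : V, u ≠ v i →
         A.cp (v ⟨i.val - 1, Nat.lt_of_le_of_lt (Nat.sub_le _ _) i.isLt⟩) ∈ A.arc u →
         A.cp u ∈ A.arc (v i)))
    (hv1 : ∃ (n : ℕ) (f : ZMod n → V), G.IsHoleOn n f ∧ ∃ j, f j = v ⟨0, hp⟩)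
    (hnonadj : ∀ i : Fin p, 2 ≤ i.val → ¬ G.Adj (v i) (v ⟨0, hp⟩)) :
    ∃ f : ZMod (holeDist G (v ⟨0, hp⟩)) → V,
      G.IsHoleOn (holeDist G (v ⟨0, hp⟩)) f ∧
      ∀ t : Fin p, f ((t.val : ℕ) : ZMod (holeDist G (v ⟨0, hp⟩))) = v t := by
  have hole : G.HasHole := hv1.imp fun _ => Exists.imp fun _ => And.left
  obtain ⟨f, hf, hf0⟩ : ∃ f : ZMod (holeDist G (v ⟨0, hp⟩)) → V,
      G.IsHoleOn (holeDist G (v ⟨0, hp⟩)) f ∧ f 0 = v ⟨0, hp⟩ := by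
    obtain ⟨f, hf, j, hj⟩ := Nat.sInf_mem hv1
    exact ⟨_, hf.comp_add j, (congrArg f (add_zero j)).trans hj⟩
  choose g hg hmax using A.exists_rightmost
  obtain ⟨k, hkn, X, hX, hXg, hadj⟩ := hhelly.exists_greedy_hole hm hproper hf hg hmax
  rw [hf0] at hXg hadj
  have hv : ∀ i (hi : i < p), v ⟨i, hi⟩ = (g^[i] (v ⟨0, hp⟩, 0)).1 := by
    intro i
    induction i with
    | zero => intro _; rfl
    | succ i ih =>
      intro hi
      obtain ⟨h1, h2⟩ := hright ⟨i + 1, hi⟩ (by simp)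
      simp only [Nat.add_sub_cancel] at h1 h2
      rw [ih (by omega)] at h1 h2
      rw [Function.iterate_succ_apply']
      exact hhelly.eq_rightmost hm hproper hole (hg _) (hmax _) h1 h2
  have hk4 := hX.1
  have hpk : p < k := by
    by_contra! h
    have h1 := hnonadj ⟨k - 1, by omega⟩ (by simp only; omega)
    rw [hv (k - 1) (by omega)] at h1
    exact h1 hadj
  have hle : holeDist G (v ⟨0, hp⟩) ≤ k := by
    refine Nat.sInf_le ⟨_, hX, 0, ?_⟩
    simp only [ZMod.val_zero]
    rw [hXg 0 (by omega)]
    rfl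
  obtain rfl : k = holeDist G (v ⟨0, hp⟩) := le_antisymm hkn hle
  refine ⟨_, hX, fun t => ?_⟩
  have ht := t.isLt
  simp only [ZMod.val_natCast_of_lt (show t.val < holeDist G (v ⟨0, hp⟩) by omega)]
  rw [hXg t.val (by omega), hv t.val ht]
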